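/- arXiv:2006.09033 — 2 statements merged into one kernel-verified Lean document; each statement's English description precedes it below -/
import Mathlib

section
/- Let F : ℝ^m → ℝ^m be monotone and L-Lipschitz, r : ℝ^m → ℝ ∪ {+∞} proper, convex and lower semicontinuous, and let B ⊂ ℝ^m be a compact set with diameter D := sup_{w,z∈B} ‖z−w‖ containing the starting point z₀. Consider the FBF iteration w_k = prox_{α_k r}(z_k − α_k F(z_k)), z_{k+1} = w_k + α_k (F(z_k) − F(w_k)) with step sizes satisfying 0 < α_k ≤ α ≤ 1/L. Then for every K ≥ 1 the averaged iterate w̄_K := (Σ_{k=0}^{K−1} α_k w_k)/(Σ_{k=0}^{K−1} α_k) satisfies G_B(w̄_K) ≤ D² / (2 Σ_{k=0}^{K−1} α_k), where G_B(w) := sup_{z∈B} ⟨F(z), w−z⟩ + r(w) − r(z). -/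
open scoped RealInnerProductSpace ENNReal
open MeasureTheory ProbabilityTheory

noncomputable section

/-- A monotone operator on a real inner product space. -/
def MonotoneOp {E : Type*} [NormedAddCommGroup E] [InnerProductSpace ℝ E]
    (F : E → E) : Prop :=
  ∀ z z' : E, 0 ≤ ⟪F z - F z', z - z'⟫

/-- An `L`-Lipschitz operator. -/
def LipschitzOp {E : Type*} [NormedAddCommGroup E] (L : ℝ) (F : E → E) : Prop :=
  ∀ z z' : E, ‖F z - F z'‖ ≤ L * ‖z - z'‖

/-- A proper function with values in `ℝ ∪ {+∞}`: it never takes the value `-∞`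
and is finite somewhere. -/
def ProperFn {E : Type*} (r : E → EReal) : Prop :=
  (∀ w, r w ≠ ⊥) ∧ (∃ w, r w ≠ ⊤)

/-- Convexity of an extended-real-valued function. -/
def ConvexFn {E : Type*} [AddCommMonoid E] [Module ℝ E] (r : E → EReal) : Prop :=
  ∀ x y : E, ∀ a b : ℝ, 0 ≤ a → 0 ≤ b → a + b = 1 →
    r (a • x + b • y) ≤ (a : EReal) * r x + (b : EReal) * r y

/-- `p` is the proximal point `prox_{lam·r}(x)`, i.e. a minimizer of
`w' ↦ r(w') + (1/(2·lam))‖w' - x‖²`. -/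
def IsProxPt {E : Type*} [NormedAddCommGroup E] (r : E → EReal) (lam : ℝ)
    (x p : E) : Prop :=
  ∀ q : E, r p + (((2 * lam)⁻¹ * ‖p - x‖ ^ 2 : ℝ) : EReal)
    ≤ r q + (((2 * lam)⁻¹ * ‖q - x‖ ^ 2 : ℝ) : EReal)

/-- One term `⟨F(z), w - z⟩ + r(w) - r(z)` of the restricted gap function,
with the convention that `∞ - ∞` is interpreted as `+∞`. -/
def gapTerm {E : Type*} [NormedAddCommGroup E] [InnerProductSpace ℝ E]
    (F : E → E) (r : E → EReal) (w z : E) : EReal :=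
  if r w = ⊤ ∧ r z = ⊤ then ⊤
  else ((⟪F z, w - z⟫ : ℝ) : EReal) + r w - r z

/-- The restricted gap function `G_B(w) = sup_{z ∈ B} ⟨F(z), w - z⟩ + r(w) - r(z)`. -/
def gapFn {E : Type*} [NormedAddCommGroup E] [InnerProductSpace ℝ E]
    (F : E → E) (r : E → EReal) (B : Set E) (w : E) : EReal :=
  ⨆ z ∈ B, gapTerm F r w z

/-- The quantity `g(w,z) = ⟨F(w), w - z⟩ + r(w) - r(z)` associated to the strong
variational inequality. -/
def gFn {E : Type*} [NormedAddCommGroup E] [InnerProductSpace ℝ E]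
    (F : E → E) (r : E → EReal) (w z : E) : EReal :=
  ((⟪F w, w - z⟫ : ℝ) : EReal) + r w - r z

/-- `w` solves the monotone inclusion `0 ∈ F(w) + ∂r(w)`, i.e. `-F(w) ∈ ∂r(w)`. -/
def SolvesInclusion {E : Type*} [NormedAddCommGroup E] [InnerProductSpace ℝ E]
    (F : E → E) (r : E → EReal) (w : E) : Prop :=
  ∀ w' : E, ((⟪-F w, w' - w⟫ : ℝ) : EReal) + r w ≤ r w'

/-- The positive part of an extended real number, as an element of `ℝ≥0∞`. -/
def erealPosPart (x : EReal) : ℝ≥0∞ :=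
  if x = ⊤ then ⊤ else ENNReal.ofReal x.toReal

/-- The expectation of an extended-real-valued random variable: the difference of
the (unsigned) integrals of its positive and negative parts. -/
def erealExp {Ω : Type*} [MeasurableSpace Ω] (μ : Measure Ω) (X : Ω → EReal) : EReal :=
  ((∫⁻ ω, erealPosPart (X ω) ∂μ : ℝ≥0∞) : EReal)
    - ((∫⁻ ω, erealPosPart (-(X ω)) ∂μ : ℝ≥0∞) : EReal)

/-- The weighted average `w̄_K = (∑_{k<K} α_k w_k) / (∑_{k<K} α_k)`. -/
def avgIter {E : Type*} [AddCommGroup E] [Module ℝ E] (α : ℕ → ℝ) (w : ℕ → E)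
    (K : ℕ) : E :=
  (∑ k ∈ Finset.range K, α k)⁻¹ • ∑ k ∈ Finset.range K, α k • w k

end

/-- A convex function with values in `ℝ ∪ {+∞}` is convex as a real-valued function on its
effective domain. -/
theorem ConvexFn.convexOn_toReal {E : Type*} [AddCommMonoid E] [Module ℝ E] {r : E → EReal}
    (hconv : ConvexFn r) (hbot : ∀ w, r w ≠ ⊥) :
    ConvexOn ℝ {x | r x ≠ ⊤} (fun x => (r x).toReal) := by
  have key : ∀ x, r x ≠ ⊤ → ∀ y, r y ≠ ⊤ → ∀ a b : ℝ, 0 ≤ a → 0 ≤ b → a + b = 1 →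
      r (a • x + b • y) ≤ ((a * (r x).toReal + b * (r y).toReal : ℝ) : EReal) := by
    intro x hx y hy a b ha hb hab
    have h := hconv x y a b ha hb hab
    rw [← EReal.coe_toReal hx (hbot x), ← EReal.coe_toReal hy (hbot y)] at h
    exact_mod_cast h
  refine ⟨fun x hx y hy a b ha hb hab => ?_, fun x hx y hy a b ha hb hab => ?_⟩
  · exact ne_top_of_le_ne_top (EReal.coe_ne_top _) (key x hx y hy a b ha hb hab)
  · exact EReal.toReal_le_toReal (key x hx y hy a b ha hb hab) (hbot _) (EReal.coe_ne_top _)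

/-- A proximal point of a proper function lies in its effective domain. -/
theorem IsProxPt.ne_top {E : Type*} [NormedAddCommGroup E] {r : E → EReal} {lam : ℝ} {x p : E}
    (hp : IsProxPt r lam x p) (hproper : ProperFn r) : r p ≠ ⊤ := by
  obtain ⟨y, hy⟩ := hproper.2
  intro h
  have h' := hp y
  rw [h, EReal.top_add_coe, top_le_iff, ← EReal.coe_toReal hy (hproper.1 y)] at h'
  exact EReal.coe_ne_top _ (by exact_mod_cast h')

/-- The variational characterization of a proximal point: `(x - p) / lam` is a subgradient of `r`
at `p`. -/
theorem IsProxPt.inner_le {E : Type*} [NormedAddCommGroup E] [InnerProductSpace ℝ E]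
    {r : E → EReal} {lam : ℝ} {x p : E} (hp : IsProxPt r lam x p) (hlam : 0 < lam)
    (hproper : ProperFn r) (hconv : ConvexFn r) {q : E} (hq : r q ≠ ⊤) :
    ⟪x - p, q - p⟫ ≤ lam * ((r q).toReal - (r p).toReal) := by
  have hptop := hp.ne_top hproper
  have hcv := hconv.convexOn_toReal hproper.1
  have step : ∀ t : ℝ, 0 < t → t ≤ 1 →
      ⟪x - p, q - p⟫ - lam * ((r q).toReal - (r p).toReal) ≤ t * (‖q - p‖ ^ 2 / 2) := by
    intro t ht ht1
    have hmem := hcv.1 hptop hq (sub_nonneg.2 ht1) ht.le (sub_add_cancel 1 t)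
    have hle := hcv.2 hptop hq (sub_nonneg.2 ht1) ht.le (sub_add_cancel 1 t)
    have hprox := hp ((1 - t) • p + t • q)
    rw [← EReal.coe_toReal hptop (hproper.1 p),
      ← EReal.coe_toReal hmem (hproper.1 _)] at hprox
    norm_cast at hprox
    have hnorm : ‖(1 - t) • p + t • q - x‖ ^ 2
        = ‖p - x‖ ^ 2 - 2 * t * ⟪x - p, q - p⟫ + t ^ 2 * ‖q - p‖ ^ 2 := by
      have : (1 - t) • p + t • q - x = t • (q - p) - (x - p) := by module
      rw [this, norm_sub_sq_real, norm_smul, inner_smul_left, real_inner_comm,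
        norm_sub_rev x p, mul_pow, Real.norm_eq_abs, sq_abs]
      simp only [conj_trivial]
      ring
    rw [hnorm] at hprox
    simp only [smul_eq_mul] at hle
    have h1 : 0 ≤ t * ((r q).toReal - (r p).toReal)
        + (2 * lam)⁻¹ * (t ^ 2 * ‖q - p‖ ^ 2 - 2 * t * ⟪x - p, q - p⟫) := by
      linarith
    have h2 : t * ((r q).toReal - (r p).toReal)
        + (2 * lam)⁻¹ * (t ^ 2 * ‖q - p‖ ^ 2 - 2 * t * ⟪x - p, q - p⟫)
        = t / lam * (lam * ((r q).toReal - (r p).toReal) + t * (‖q - p‖ ^ 2 / 2)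
          - ⟪x - p, q - p⟫) := by
      field_simp
      ring
    rw [h2] at h1
    have := nonneg_of_mul_nonneg_right h1 (div_pos ht hlam)
    linarith
  have hlim : Filter.Tendsto (fun t : ℝ => t * (‖q - p‖ ^ 2 / 2)) (nhdsWithin 0 (Set.Ioi 0))
      (nhds 0) := by
    have : Continuous (fun t : ℝ => t * (‖q - p‖ ^ 2 / 2)) := by fun_prop
    simpa using (this.tendsto 0).mono_left nhdsWithin_le_nhds
  have := ge_of_tendsto hlim (by
    filter_upwards [Ioc_mem_nhdsGT (zero_lt_one' ℝ)] with t ht using step t ht.1 ht.2)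
  linarith

/-- The descent inequality of one forward-backward-forward step. -/
theorem fbf_step {E : Type*} [NormedAddCommGroup E] [InnerProductSpace ℝ E]
    {F : E → E} {L : ℝ} (hlip : LipschitzOp L F) {r : E → EReal} (hproper : ProperFn r)
    (hconv : ConvexFn r) {lam : ℝ} (hlam : 0 < lam) (hlamL : lam * L ≤ 1) {x w : E}
    (hw : IsProxPt r lam (x - lam • F x) w) {u : E} (hu : r u ≠ ⊤) :
    lam * (⟪F w, w - u⟫ + (r w).toReal - (r u).toReal)
      ≤ (‖x - u‖ ^ 2 - ‖w + lam • (F x - F w) - u‖ ^ 2) / 2 := by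
  have hprox := hw.inner_le hlam hproper hconv hu
  have hnorm : ‖lam • (F x - F w)‖ ^ 2 ≤ ‖x - w‖ ^ 2 := by
    refine pow_le_pow_left₀ (norm_nonneg _) ?_ 2
    rw [norm_smul, Real.norm_of_nonneg hlam.le]
    calc lam * ‖F x - F w‖ ≤ lam * (L * ‖x - w‖) := by gcongr; exact hlip x w
      _ = lam * L * ‖x - w‖ := by ring
      _ ≤ 1 * ‖x - w‖ := by gcongr
      _ = ‖x - w‖ := one_mul _
  have e1 : ‖x - u‖ ^ 2 = ‖x - w‖ ^ 2 + 2 * ⟪x - w, w - u⟫ + ‖w - u‖ ^ 2 := by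
    rw [← norm_add_sq_real, sub_add_sub_cancel]
  have e2 : ‖w + lam • (F x - F w) - u‖ ^ 2 = ‖lam • (F x - F w)‖ ^ 2
      + 2 * (lam * (⟪F x, w - u⟫ - ⟪F w, w - u⟫)) + ‖w - u‖ ^ 2 := by
    have : w + lam • (F x - F w) - u = lam • (F x - F w) + (w - u) := by abel
    rw [this, norm_add_sq_real, real_inner_smul_left, inner_sub_left]
  have e3 : ⟪x - lam • F x - w, u - w⟫ = -⟪x - w, w - u⟫ + lam * ⟪F x, w - u⟫ := by
    have h1 : x - lam • F x - w = (x - w) - lam • F x := by abel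
    rw [h1, ← neg_sub w u, inner_neg_right, inner_sub_left, real_inner_smul_left]
    ring
  rw [e3] at hprox
  rw [e1, e2]
  linarith

/-- Deterministic FBF convergence, Theorem 1(i)/Theorem 4(i).
For a monotone `L`-Lipschitz operator `F` and a proper convex lsc regularizer `r`,
the FBF iteration `w_k = prox_{α_k r}(z_k - α_k F(z_k))`,
`z_{k+1} = w_k + α_k (F(z_k) - F(w_k))` with `0 < α_k ≤ α ≤ 1/L` satisfies
`G_B(w̄_K) ≤ D² / (2 ∑_{k<K} α_k)` for the averaged iterates. -/
theorem fbf_deterministic {m : ℕ}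
    (F : EuclideanSpace ℝ (Fin m) → EuclideanSpace ℝ (Fin m)) (L : ℝ) (hL : 0 < L)
    (hmono : MonotoneOp F) (hlip : LipschitzOp L F)
    (r : EuclideanSpace ℝ (Fin m) → EReal)
    (hproper : ProperFn r) (hconv : ConvexFn r) (hlsc : LowerSemicontinuous r)
    (B : Set (EuclideanSpace ℝ (Fin m))) (hB : IsCompact B)
    (α : ℕ → ℝ) (a : ℝ)
    (hαpos : ∀ k, 0 < α k) (hαa : ∀ k, α k ≤ a) (haL : a ≤ 1 / L)
    (z w : ℕ → EuclideanSpace ℝ (Fin m)) (hz0 : z 0 ∈ B)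
    (hw : ∀ k, IsProxPt r (α k) (z k - α k • F (z k)) (w k))
    (hz : ∀ k, z (k + 1) = w k + α k • (F (z k) - F (w k)))
    (K : ℕ) (hK : 1 ≤ K) :
    gapFn F r B (avgIter α w K)
      ≤ ((Metric.diam B ^ 2 / (2 * ∑ k ∈ Finset.range K, α k) : ℝ) : EReal) := by
  have hwtop : ∀ k, r (w k) ≠ ⊤ := fun k => (hw k).ne_top hproper
  have hcv := hconv.convexOn_toReal hproper.1
  set S := ∑ k ∈ Finset.range K, α k with hS
  have hSpos : 0 < S :=
    Finset.sum_pos (fun k _ => hαpos k) (Finset.nonempty_range_iff.2 (by omega))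
  have havg : avgIter α w K = (Finset.range K).centerMass α w := rfl
  have hwbar : r (avgIter α w K) ≠ ⊤ := by
    rw [havg]
    exact hcv.1.centerMass_mem (fun k _ => (hαpos k).le) hSpos (fun k _ => hwtop k)
  have hjensen : S * (r (avgIter α w K)).toReal
      ≤ ∑ k ∈ Finset.range K, α k * (r (w k)).toReal := by
    have h := hcv.map_centerMass_le (t := Finset.range K) (w := α) (p := w)
      (fun k _ => (hαpos k).le) hSpos (fun k _ => hwtop k)
    rw [← havg, Finset.centerMass, ← hS, smul_eq_mul, le_inv_mul_iff₀ hSpos] at h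
    simpa only [Function.comp_apply, smul_eq_mul] using h
  refine iSup₂_le fun u hu => ?_
  rw [gapTerm, if_neg fun h => hwbar h.1]
  by_cases hutop : r u = ⊤
  · rw [hutop, EReal.sub_top]
    exact bot_le
  rw [← EReal.coe_toReal hwbar (hproper.1 _), ← EReal.coe_toReal hutop (hproper.1 u)]
  norm_cast
  have hstep : ∀ k, α k * (⟪F u, w k - u⟫ + (r (w k)).toReal - (r u).toReal)
      ≤ ‖z k - u‖ ^ 2 / 2 - ‖z (k + 1) - u‖ ^ 2 / 2 := by
    intro k
    have hαL : α k * L ≤ 1 := (le_div_iff₀ hL).1 ((hαa k).trans haL)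
    have h := fbf_step hlip hproper hconv (hαpos k) hαL (hw k) hutop
    rw [← hz k] at h
    have hm := hmono (w k) u
    rw [inner_sub_left] at hm
    have := mul_nonneg (hαpos k).le hm
    linarith
  have hsum := Finset.sum_le_sum fun k (_ : k ∈ Finset.range K) => hstep k
  rw [Finset.sum_range_sub' (fun k => ‖z k - u‖ ^ 2 / 2)] at hsum
  have hinner : S * ⟪F u, avgIter α w K - u⟫ = ∑ k ∈ Finset.range K, α k * ⟪F u, w k - u⟫ := by
    have : S • (avgIter α w K - u) = ∑ k ∈ Finset.range K, α k • (w k - u) := by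
      simp only [smul_sub, Finset.sum_sub_distrib, ← Finset.sum_smul, avgIter, ← hS,
        smul_inv_smul₀ hSpos.ne']
    rw [← real_inner_smul_right, this, inner_sum]
    simp only [real_inner_smul_right]
  have hsplit : ∑ k ∈ Finset.range K, α k * (⟪F u, w k - u⟫ + (r (w k)).toReal - (r u).toReal)
      = S * ⟪F u, avgIter α w K - u⟫ + ∑ k ∈ Finset.range K, α k * (r (w k)).toReal
        - S * (r u).toReal := by
    rw [hinner, hS, Finset.sum_mul, ← Finset.sum_add_distrib, ← Finset.sum_sub_distrib]
    exact Finset.sum_congr rfl fun k _ => by ring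
  have hdiam : ‖z 0 - u‖ ^ 2 ≤ Metric.diam B ^ 2 := by
    refine pow_le_pow_left₀ (norm_nonneg _) ?_ 2
    rw [← dist_eq_norm]
    exact Metric.dist_le_diam_of_mem hB.isBounded hz0 hu
  rw [le_div_iff₀ (by positivity)]
  have := sq_nonneg ‖z K - u‖
  linarith
end

section
/- Let F : ℝ^m → ℝ^m be monotone and continuous, r : ℝ^m → ℝ ∪ {+∞} proper, convex and lower semicontinuous, and B ⊂ ℝ^m. A point w* in the interior of B solves the monotone inclusion 0 ∈ F(w) + ∂r(w) if and only if its restricted gap is zero, G_B(w*) = 0, where G_B(w) := sup_{z∈B} ⟨F(z), w−z⟩ + r(w) − r(z); moreover G_B is nonnegative on B. -/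
open scoped RealInnerProductSpace ENNReal
open MeasureTheory ProbabilityTheory

section GapLemmas

variable {E : Type*} [NormedAddCommGroup E] [InnerProductSpace ℝ E]

lemma gapTerm_self_nonneg (F : E → E) {r : E → EReal} {w : E} (hbot : r w ≠ ⊥) :
    0 ≤ gapTerm F r w w := by
  unfold gapTerm
  split_ifs with h
  · exact le_top
  · have htop : r w ≠ ⊤ := fun h' => h ⟨h', h'⟩
    lift r w to ℝ using ⟨htop, hbot⟩ with a
    simp

lemma gapFn_nonneg (F : E → E) {r : E → EReal} {B : Set E} {w : E} (hw : w ∈ B)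
    (hbot : r w ≠ ⊥) : 0 ≤ gapFn F r B w :=
  (gapTerm_self_nonneg F hbot).trans (le_iSup₂ (f := fun z _ => gapTerm F r w z) w hw)

lemma gapTerm_nonpos_iff (F : E → E) {r : E → EReal} {w z : E}
    (htop : r w ≠ ⊤) (hbot : r w ≠ ⊥) (hz : r z ≠ ⊥) :
    gapTerm F r w z ≤ 0 ↔ ((⟪F z, w - z⟫ : ℝ) : EReal) + r w ≤ r z := by
  rw [gapTerm, if_neg (fun h => htop h.1)]
  lift r w to ℝ using ⟨htop, hbot⟩ with a
  by_cases hzt : r z = ⊤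
  · simp [hzt, ← EReal.coe_add]
  · lift r z to ℝ using ⟨hzt, hz⟩ with b
    norm_cast
    exact sub_nonpos

lemma SolvesInclusion.ne_top {F : E → E} {r : E → EReal} {w : E}
    (h : SolvesInclusion F r w) (hproper : ProperFn r) : r w ≠ ⊤ := by
  intro htop
  obtain ⟨v, hv⟩ := hproper.2
  have := h v
  rw [htop, EReal.coe_add_top, top_le_iff] at this
  exact hv this

lemma SolvesInclusion.gapTerm_nonpos {F : E → E} {r : E → EReal} {w : E}
    (h : SolvesInclusion F r w) (hmono : MonotoneOp F) (hproper : ProperFn r) (z : E) :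
    gapTerm F r w z ≤ 0 := by
  rw [gapTerm_nonpos_iff F (h.ne_top hproper) (hproper.1 w) (hproper.1 z)]
  refine le_trans (add_le_add_left (EReal.coe_le_coe_iff.2 ?_) _) (h z)
  have := hmono w z
  rw [inner_sub_left] at this
  rw [inner_neg_left, ← inner_neg_right, neg_sub]
  linarith

open Filter Topology in
/-- Minty's lemma, localised at an interior point: a solution of the weak variational inequality
tested near `w` solves the inclusion. -/
lemma solvesInclusion_of_forall_mem_nhds {F : E → E} {r : E → EReal} {w : E} {B : Set E}
    (hcont : Continuous F) (hproper : ProperFn r) (hconv : ConvexFn r) (hB : B ∈ 𝓝 w)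
    (htop : r w ≠ ⊤)
    (h : ∀ z ∈ B, ((⟪F z, w - z⟫ : ℝ) : EReal) + r w ≤ r z) :
    SolvesInclusion F r w := by
  intro v
  by_cases hv : r v = ⊤
  · rw [hv]; exact le_top
  obtain ⟨a, ha⟩ : ∃ a : ℝ, (a : EReal) = r w := ⟨_, EReal.coe_toReal htop (hproper.1 w)⟩
  obtain ⟨b, hb⟩ : ∃ b : ℝ, (b : EReal) = r v := ⟨_, EReal.coe_toReal hv (hproper.1 v)⟩
  let z : ℝ → E := fun t => (1 - t) • w + t • v
  have hz : Continuous z := by fun_prop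
  have hz0 : z 0 = w := by simp [z]
  have hmem : ∀ᶠ t in 𝓝[>] (0 : ℝ), z t ∈ B :=
    (hz.tendsto 0).mono_left nhdsWithin_le_nhds (by rwa [hz0])
  have hlt : ∀ᶠ t in 𝓝[>] (0 : ℝ), t < 1 :=
    nhdsWithin_le_nhds (Iio_mem_nhds one_pos)
  have hle : ∀ᶠ t in 𝓝[>] (0 : ℝ), ⟪F (z t), w - v⟫ ≤ b - a := by
    filter_upwards [hmem, hlt, self_mem_nhdsWithin] with t htB ht1 ht0
    have ht0 : 0 < t := ht0
    have key := (h _ htB).trans (hconv w v (1 - t) t (by linarith) ht0.le (by ring))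
    have hsub : w - z t = t • (w - v) := by simp only [z]; module
    rw [hsub, inner_smul_right, ← ha, ← hb] at key
    norm_cast at key
    refine le_of_mul_le_mul_left ?_ ht0
    linarith
  have hlim : Tendsto (fun t => ⟪F (z t), w - v⟫) (𝓝[>] (0 : ℝ)) (𝓝 ⟪F w, w - v⟫) := by
    have : Continuous fun t => ⟪F (z t), w - v⟫ := by fun_prop
    simpa only [hz0] using (this.tendsto 0).mono_left nhdsWithin_le_nhds
  have hfin := le_of_tendsto hlim hle
  rw [inner_neg_left, ← inner_neg_right, neg_sub, ← ha, ← hb]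
  norm_cast
  linarith

end GapLemmas

/-- Theorem 8: the restricted gap characterizes solutions of the
monotone inclusion. For `F` monotone and continuous and `r` proper convex lsc, a
point `w*` in the interior of `B` solves `0 ∈ F(w) + ∂r(w)` iff `G_B(w*) = 0`;
moreover `G_B ≥ 0` on `B`. -/
theorem gap_characterizes_inclusion_solutions {m : ℕ}
    (F : EuclideanSpace ℝ (Fin m) → EuclideanSpace ℝ (Fin m))
    (hmono : MonotoneOp F) (hcont : Continuous F)
    (r : EuclideanSpace ℝ (Fin m) → EReal)
    (hproper : ProperFn r) (hconv : ConvexFn r) (hlsc : LowerSemicontinuous r)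
    (B : Set (EuclideanSpace ℝ (Fin m)))
    (ws : EuclideanSpace ℝ (Fin m)) (hmem : ws ∈ interior B) :
    (SolvesInclusion F r ws ↔ gapFn F r B ws = 0)
    ∧ (∀ w ∈ B, 0 ≤ gapFn F r B w) := by
  have hB : ws ∈ B := interior_subset hmem
  refine ⟨⟨fun h => ?_, fun h => ?_⟩, fun w hw => gapFn_nonneg F hw (hproper.1 w)⟩
  · exact le_antisymm (iSup₂_le fun z _ => h.gapTerm_nonpos hmono hproper z)
      (gapFn_nonneg F hB (hproper.1 ws))
  · have hle : ∀ z ∈ B, gapTerm F r ws z ≤ 0 := iSup₂_le_iff.1 h.le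
    have htop : r ws ≠ ⊤ := fun htop => by
      simpa [gapTerm, htop] using hle ws hB
    exact solvesInclusion_of_forall_mem_nhds hcont hproper hconv
      (mem_interior_iff_mem_nhds.1 hmem) htop fun z hz =>
        (gapTerm_nonpos_iff F htop (hproper.1 ws) (hproper.1 z)).1 (hle z hz)
end
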